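/- Let d ≥ 2, let p be a prime, let Γ ≤ SL_d(ℤ) be a countably infinite subgroup, and let S ⊆ Γ be a finite symmetric set such that for some ε > 0 and every k ≥ 1, h(SL_d(ℤ/p^kℤ), π_{p^k}(S)) ≥ ε. Set δ := ε/(32|S|) and N := ⌊√(p−1)/25⌋; assume N ≥ 1. Let α: Γ ↷ SL_d(ℤ_p) be the left-multiplication action via the natural embedding SL_d(ℤ) ↪ SL_d(ℤ_p), where SL_d(ℤ_p) carries the Haar probability measure. Then u ∈ C(α × α, S, 2), yet every N-step function f ∈ Step_{2,N}(SL_d(ℤ_p); SL_d(ℤ_p)) satisfies dist_∞(u, M^{α×α}_{S,2}[f]) ≥ δ. -/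

import Mathlib

open MeasureTheory

/-- `G_n = SL_d(ℤ/nℤ)`. -/
abbrev SLmod (d n : ℕ) := Matrix.SpecialLinearGroup (Fin d) (ZMod n)

/-- Reduction modulo `n`, as a homomorphism `SL_d(ℤ) → SL_d(ℤ/nℤ)`. -/
def redZ (d n : ℕ) : Matrix.SpecialLinearGroup (Fin d) ℤ →* SLmod d n :=
  Matrix.SpecialLinearGroup.map (Int.castRingHom (ZMod n))

/-- The boundary `∂(A,S) = {a ∈ A : S·a ⊄ A}` of a set `A` with respect to `S`. -/
def bdry {G : Type*} [Group G] (A S : Set G) : Set G :=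
  {a ∈ A | ¬ ∀ s ∈ S, s * a ∈ A}

/-- The Cheeger constant `h(G,S) = min { |∂(A,S)|/|A| : ∅ ≠ A ⊆ G, |A| ≤ |G|/2 }` of a
finite group `G` with respect to `S ⊆ G`. -/
noncomputable def cheeger (G : Type*) [Group G] [Finite G] (S : Set G) : ℝ :=
  sInf {r : ℝ | ∃ A : Set G, A.Nonempty ∧ 2 * A.ncard ≤ Nat.card G ∧
    r = (bdry A S).ncard / A.ncard}

/-- `SL_d(ℤ_p)`, the compact group of `d×d` matrices of determinant `1` over the `p`-adic
integers. -/
abbrev SLp (d p : ℕ) [Fact p.Prime] := Matrix.SpecialLinearGroup (Fin d) ℤ_[p]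

/-- `SL_d(ℤ_p)` is topologized as a subspace of the space of matrices over `ℤ_p`. -/
noncomputable instance (d p : ℕ) [Fact p.Prime] : TopologicalSpace (SLp d p) :=
  instTopologicalSpaceSubtype

/-- The natural embedding `SL_d(ℤ) ↪ SL_d(ℤ_p)`. -/
noncomputable def embZp (d p : ℕ) [Fact p.Prime] : Matrix.SpecialLinearGroup (Fin d) ℤ →* SLp d p :=
  Matrix.SpecialLinearGroup.map (Int.castRingHom ℤ_[p])

/-- The vector `M^{α×α}_{S,2}[f] ∈ [0,1]^{S×2×2}` for the product `α × α` of the left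
multiplication action `α : Γ ↷ (SL_d(ℤ_p), μ)` with itself (`S` being a finite subset of
`SL_d(ℤ)`):  `M[f](γ,i,j) = (μ×μ) {w : f w = i ∧ f (γ·w) = j}`.
(The space `↥S × Fin 2 × Fin 2 → ℝ` carries the sup metric `dist_∞`.) -/
noncomputable def Mp (d p : ℕ) [Fact p.Prime] [MeasurableSpace (SLp d p)]
    (μ : Measure (SLp d p)) (S : Finset (Matrix.SpecialLinearGroup (Fin d) ℤ))
    (f : SLp d p × SLp d p → Fin 2) : ↥S × Fin 2 × Fin 2 → ℝ :=
  fun q => ((μ.prod μ) {w | f w = q.2.1 ∧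
      f (embZp d p (q.1 : Matrix.SpecialLinearGroup (Fin d) ℤ) * w.1,
         embZp d p (q.1 : Matrix.SpecialLinearGroup (Fin d) ℤ) * w.2) = q.2.2}).toReal

/-- The vector `u ∈ [0,1]^{S×2×2}` with `u(γ,i,j) = 1/2` if `i = j` and `= 0` otherwise. -/
noncomputable def uVec {Γ : Type*} (S : Finset Γ) : ↥S × Fin 2 × Fin 2 → ℝ :=
  fun q => if q.2.1 = q.2.2 then 1 / 2 else 0


/-- The multiplicative monoid generated by elementary transvections. -/
def transvectionMonoid (n R : Type*) [Fintype n] [DecidableEq n] [CommRing R] :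
    Submonoid (Matrix n n R) :=
  Submonoid.closure {M | ∃ (i j : n) (c : R), i ≠ j ∧ M = Matrix.transvection i j c}

section Generation

variable {R : Type*} [CommRing R]

theorem transvection_mem_transvectionMonoid {n : Type*} [Fintype n] [DecidableEq n] {i j : n}
    (hij : i ≠ j) (c : R) : Matrix.transvection i j c ∈ transvectionMonoid n R :=
  Submonoid.subset_closure ⟨i, j, c, hij, rfl⟩

theorem mem_transvectionMonoid_of_transvection_mul {n : Type*} [Fintype n] [DecidableEq n]
    {i j : n} (hij : i ≠ j) (c : R) {M : Matrix n n R}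
    (h : Matrix.transvection i j c * M ∈ transvectionMonoid n R) :
    M ∈ transvectionMonoid n R := by
  have := mul_mem (transvection_mem_transvectionMonoid hij (-c)) h
  rwa [← mul_assoc, Matrix.transvection_mul_transvection_same _ _ hij, neg_add_cancel,
    Matrix.transvection_zero, one_mul] at this

theorem mem_transvectionMonoid_of_mul_transvection {n : Type*} [Fintype n] [DecidableEq n]
    {i j : n} (hij : i ≠ j) (c : R) {M : Matrix n n R}
    (h : M * Matrix.transvection i j c ∈ transvectionMonoid n R) :
    M ∈ transvectionMonoid n R := by
  have := mul_mem h (transvection_mem_transvectionMonoid hij (-c))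
  rwa [mul_assoc, Matrix.transvection_mul_transvection_same _ _ hij, add_neg_cancel,
    Matrix.transvection_zero, mul_one] at this

/-- The block diagonal matrix `diag(1, M)`. -/
def oneBlock {n : ℕ} (M : Matrix (Fin n) (Fin n) R) : Matrix (Fin (n + 1)) (Fin (n + 1)) R :=
  Matrix.of (Fin.cons (Fin.cons 1 0) (fun i => Fin.cons 0 (M i)))

theorem oneBlock_mem_transvectionMonoid {n : ℕ} {M : Matrix (Fin n) (Fin n) R}
    (h : M ∈ transvectionMonoid (Fin n) R) :
    oneBlock M ∈ transvectionMonoid (Fin (n + 1)) R := by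
  induction h using Submonoid.closure_induction with
  | mem M hM =>
    obtain ⟨i, j, c, hij, rfl⟩ := hM
    convert transvection_mem_transvectionMonoid (R := R)
      (fun h => hij (Fin.succ_injective _ h) : i.succ ≠ j.succ) c using 1
    ext a b
    cases a using Fin.cases <;> cases b using Fin.cases <;>
      simp [oneBlock, Matrix.transvection, Matrix.one_apply, Matrix.single_apply,
        Fin.succ_ne_zero, (Fin.succ_ne_zero _).symm]
  | one =>
    convert one_mem (transvectionMonoid (Fin (n + 1)) R) using 1
    ext a b
    cases a using Fin.cases <;> cases b using Fin.cases <;>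
      simp [oneBlock, Matrix.one_apply, Fin.succ_ne_zero, (Fin.succ_ne_zero _).symm]
  | mul A B _ _ hA hB =>
    convert mul_mem hA hB using 1
    ext a b
    cases a using Fin.cases <;> cases b using Fin.cases <;>
      simp [oneBlock, Matrix.mul_apply, Fin.sum_univ_succ]

theorem mem_transvectionMonoid_of_col_row {n : ℕ}
    (ih : ∀ M : Matrix (Fin n) (Fin n) R, M.det = 1 → M ∈ transvectionMonoid (Fin n) R)
    (M : Matrix (Fin (n + 1)) (Fin (n + 1)) R) (hdet : M.det = 1) (h00 : M 0 0 = 1)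
    (hcol : ∀ i : Fin n, M i.succ 0 = 0) (hrow : ∀ i : Fin n, M 0 i.succ = 0) :
    M ∈ transvectionMonoid (Fin (n + 1)) R := by
  have hM : oneBlock (M.submatrix Fin.succ Fin.succ) = M := by
    ext a b
    cases a using Fin.cases <;> cases b using Fin.cases <;> simp [oneBlock, h00, hcol, hrow]
  rw [← hM]
  refine oneBlock_mem_transvectionMonoid (ih _ ?_)
  rw [Matrix.det_succ_column_zero, Fin.sum_univ_succ] at hdet
  simpa [h00, hcol] using hdet

theorem mem_transvectionMonoid_of_col {n : ℕ}
    (ih : ∀ M : Matrix (Fin n) (Fin n) R, M.det = 1 → M ∈ transvectionMonoid (Fin n) R)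
    (s : Finset (Fin n)) :
    ∀ M : Matrix (Fin (n + 1)) (Fin (n + 1)) R, M.det = 1 → M 0 0 = 1 →
    (∀ i : Fin n, M i.succ 0 = 0) → (∀ i : Fin n, i ∉ s → M 0 i.succ = 0) →
    M ∈ transvectionMonoid (Fin (n + 1)) R := by
  induction s using Finset.induction_on with
  | empty => exact fun M hd h0 hc hr =>
      mem_transvectionMonoid_of_col_row ih M hd h0 hc (fun i => hr i (by simp))
  | insert a s _ hs =>
    intro M hd h0 hc hr
    refine mem_transvectionMonoid_of_mul_transvection (Fin.succ_ne_zero a).symm (-M 0 a.succ)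
      (hs _ ?_ ?_ ?_ ?_)
    · rw [Matrix.det_mul, hd, Matrix.det_transvection_of_ne _ _ (Fin.succ_ne_zero a).symm, one_mul]
    · rw [Matrix.mul_transvection_apply_of_ne _ _ _ _ (Fin.succ_ne_zero a).symm, h0]
    · intro i
      rw [Matrix.mul_transvection_apply_of_ne _ _ _ _ (Fin.succ_ne_zero a).symm, hc]
    · intro i hi
      by_cases hia : i = a
      · subst hia
        rw [Matrix.mul_transvection_apply_same, h0]
        ring
      · rw [Matrix.mul_transvection_apply_of_ne _ _ _ _ (fun h => hia (Fin.succ_injective _ h))]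
        exact hr i (by simp [hia, hi])

theorem mem_transvectionMonoid_of_corner {n : ℕ}
    (ih : ∀ M : Matrix (Fin n) (Fin n) R, M.det = 1 → M ∈ transvectionMonoid (Fin n) R)
    (s : Finset (Fin n)) :
    ∀ M : Matrix (Fin (n + 1)) (Fin (n + 1)) R, M.det = 1 → M 0 0 = 1 →
    (∀ i : Fin n, i ∉ s → M i.succ 0 = 0) →
    M ∈ transvectionMonoid (Fin (n + 1)) R := by
  induction s using Finset.induction_on with
  | empty => exact fun M hd h0 hc =>
      mem_transvectionMonoid_of_col ih Finset.univ M hd h0 (fun i => hc i (by simp)) (by simp)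
  | insert a s _ hs =>
    intro M hd h0 hc
    refine mem_transvectionMonoid_of_transvection_mul (Fin.succ_ne_zero a) (-M a.succ 0)
      (hs _ ?_ ?_ ?_)
    · rw [Matrix.det_mul, hd, Matrix.det_transvection_of_ne _ _ (Fin.succ_ne_zero a), one_mul]
    · rw [Matrix.transvection_mul_apply_of_ne _ _ _ _ (Fin.succ_ne_zero a).symm, h0]
    · intro i hi
      by_cases hia : i = a
      · subst hia
        rw [Matrix.transvection_mul_apply_same, h0]
        ring
      · rw [Matrix.transvection_mul_apply_of_ne _ _ _ _ (fun h => hia (Fin.succ_injective _ h))]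
        exact hc i (by simp [hia, hi])

theorem mem_transvectionMonoid_of_isUnit_succ {n : ℕ}
    (ih : ∀ M : Matrix (Fin n) (Fin n) R, M.det = 1 → M ∈ transvectionMonoid (Fin n) R)
    (M : Matrix (Fin (n + 1)) (Fin (n + 1)) R) (hd : M.det = 1) (i : Fin n)
    (hu : IsUnit (M i.succ 0)) : M ∈ transvectionMonoid (Fin (n + 1)) R := by
  obtain ⟨b, hb⟩ := hu.exists_left_inv
  have hne := (Fin.succ_ne_zero i).symm
  refine mem_transvectionMonoid_of_transvection_mul hne ((1 - M 0 0) * b)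
    (mem_transvectionMonoid_of_corner ih Finset.univ _ ?_ ?_ (by simp))
  · rw [Matrix.det_mul, hd, Matrix.det_transvection_of_ne _ _ hne, one_mul]
  · rw [Matrix.transvection_mul_apply_same, mul_assoc, hb]
    ring

/-- Over a local ring, every matrix of determinant one is a product of transvections. -/
theorem mem_transvectionMonoid_of_det_eq_one [IsLocalRing R] (n : ℕ) :
    ∀ M : Matrix (Fin n) (Fin n) R, M.det = 1 → M ∈ transvectionMonoid (Fin n) R := by
  induction n with
  | zero =>
    intro M _
    rw [Subsingleton.elim M 1]
    exact one_mem _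
  | succ n ih =>
    intro M hd
    obtain ⟨i, hi⟩ : ∃ i, IsUnit (M i 0) := by
      by_contra! hcon
      have h1 : M.det ∈ IsLocalRing.maximalIdeal R := by
        rw [Matrix.det_succ_column_zero]
        refine Ideal.sum_mem _ fun i _ => Ideal.mul_mem_right _ _ (Ideal.mul_mem_left _ _ ?_)
        exact (IsLocalRing.mem_maximalIdeal _).2 (hcon i)
      rw [hd] at h1
      exact (IsLocalRing.mem_maximalIdeal _).1 h1 isUnit_one
    cases i using Fin.cases with
    | succ i => exact mem_transvectionMonoid_of_isUnit_succ ih M hd i hi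
    | zero =>
      cases n with
      | zero =>
        have : M = 1 := by
          ext a b
          rw [Fin.fin_one_eq_zero a, Fin.fin_one_eq_zero b]
          simpa using hd
        rw [this]
        exact one_mem _
      | succ n =>
        obtain ⟨b, hb⟩ := hi.exists_left_inv
        have hne : (Fin.succ 0 : Fin (n + 2)) ≠ 0 := Fin.succ_ne_zero 0
        refine mem_transvectionMonoid_of_transvection_mul hne
          ((1 - M (Fin.succ 0) 0) * b) (mem_transvectionMonoid_of_isUnit_succ ih _ ?_ 0 ?_)
        · rw [Matrix.det_mul, hd, Matrix.det_transvection_of_ne _ _ hne, one_mul]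
        · rw [Matrix.transvection_mul_apply_same, mul_assoc, hb]
          simp

/-- A homomorphism out of `SL_n` of a local ring that kills all transvections is trivial. -/
theorem monoidHom_eq_one_of_transvection [IsLocalRing R] {n : ℕ} {H : Type*} [Monoid H]
    (ρ : Matrix.SpecialLinearGroup (Fin n) R →* H)
    (h : ∀ (i j : Fin n) (hij : i ≠ j) (c : R),
      ρ (Matrix.SpecialLinearGroup.transvection hij c) = 1) : ρ = 1 := by
  have key : ∀ M ∈ transvectionMonoid (Fin n) R,
      ∃ hM : M.det = 1, ρ ⟨M, hM⟩ = 1 := by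
    intro M hM
    induction hM using Submonoid.closure_induction with
    | mem M hM =>
      obtain ⟨i, j, c, hij, rfl⟩ := hM
      exact ⟨Matrix.det_transvection_of_ne _ _ hij _, h i j hij c⟩
    | one => exact ⟨Matrix.det_one, map_one ρ⟩
    | mul A B _ _ hA hB =>
      obtain ⟨hA, hA'⟩ := hA
      obtain ⟨hB, hB'⟩ := hB
      refine ⟨by rw [Matrix.det_mul, hA, hB, one_mul], ?_⟩
      let a : Matrix.SpecialLinearGroup (Fin n) R := ⟨A, hA⟩
      let b : Matrix.SpecialLinearGroup (Fin n) R := ⟨B, hB⟩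
      change ρ (a * b) = 1
      rw [map_mul, show ρ a = 1 from hA', show ρ b = 1 from hB', one_mul]
  ext g
  exact (key g.1 (mem_transvectionMonoid_of_det_eq_one n g.1 g.2)).2

end Generation

theorem exists_eigenvalue_ne_one {V : Type*} [AddCommGroup V] [Module ℂ V]
    [FiniteDimensional ℂ V] (A : Module.End ℂ V) (q : ℕ) (hq : q ≠ 0) (hA : A ^ q = 1)
    (hA1 : A ≠ 1) : ∃ ζ : ℂ, ζ ≠ 1 ∧ A.HasEigenvalue ζ := by
  have hgeom : (∑ i ∈ Finset.range q, A ^ i) * (A - 1) = 0 := by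
    rw [geom_sum_mul, hA, sub_self]
  set W : Submodule ℂ V := LinearMap.ker (∑ i ∈ Finset.range q, A ^ i) with hW
  have hcomm : Commute (∑ i ∈ Finset.range q, A ^ i) A :=
    Commute.sum_left _ _ _ fun i _ => (Commute.refl A).pow_left i
  have hmap : ∀ w ∈ W, A w ∈ W := by
    intro w hw
    rw [hW, LinearMap.mem_ker] at hw ⊢
    rw [← Module.End.mul_apply, hcomm.eq, Module.End.mul_apply, hw, map_zero]
  have hWne : Nontrivial W := by
    rw [Submodule.nontrivial_iff_ne_bot]
    intro hbot
    apply hA1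
    rw [← sub_eq_zero]
    ext v
    have : (A - 1) v ∈ W := by
      rw [hW, LinearMap.mem_ker, ← Module.End.mul_apply, hgeom, LinearMap.zero_apply]
    rw [hbot, Submodule.mem_bot] at this
    simpa using this
  obtain ⟨ζ, hζ⟩ := Module.End.exists_eigenvalue (A.restrict hmap)
  obtain ⟨w, hw⟩ := hζ.exists_hasEigenvector
  have hAw : A (w : V) = ζ • (w : V) := by
    simpa using congrArg Subtype.val hw.apply_eq_smul
  have hw0 : (w : V) ≠ 0 := by simpa using hw.2
  refine ⟨ζ, ?_, Module.End.hasEigenvalue_of_hasEigenvector (x := (w : V))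
    ⟨Module.End.mem_eigenspace_iff.2 hAw, hw0⟩⟩
  rintro rfl
  rw [one_smul] at hAw
  have hpow : ∀ i : ℕ, (A ^ i) (w : V) = w := by
    intro i
    induction i with
    | zero => simp
    | succ i ih => rw [pow_succ, Module.End.mul_apply, hAw, ih]
  have : (w : V) ∈ LinearMap.ker (∑ i ∈ Finset.range q, A ^ i) := w.2
  rw [LinearMap.mem_ker, LinearMap.sum_apply] at this
  simp only [hpow, Finset.sum_const, Finset.card_range] at this
  rw [← Nat.cast_smul_eq_nsmul ℂ, smul_eq_zero] at this
  simp [hq, hw0] at this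

theorem half_le_finrank_of_conj_sq {V : Type*} [AddCommGroup V] [Module ℂ V]
    [FiniteDimensional ℂ V] (p k : ℕ) (hp : p.Prime) (A : Module.End ℂ V)
    (hA : A ^ (p ^ k) = 1) (hA1 : A ≠ 1)
    (hconj : ∀ a : ℕ, 0 < a → a < p → ∃ H : Module.End ℂ V, Function.Injective H ∧
      A * H = H * A ^ (a ^ 2)) : (p - 1) / 2 ≤ Module.finrank ℂ V := by
  obtain ⟨ζ, hζ1, hζ⟩ := exists_eigenvalue_ne_one A (p ^ k) (pow_ne_zero _ hp.ne_zero) hA hA1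
  obtain ⟨v, hv⟩ := hζ.exists_hasEigenvector
  have hpowv : ∀ i : ℕ, (A ^ i) v = ζ ^ i • v := by
    intro i
    induction i with
    | zero => simp
    | succ i ih => rw [pow_succ, Module.End.mul_apply, hv.apply_eq_smul, map_smul, ih, smul_smul,
        pow_succ, mul_comm]
  have hζq : ζ ^ (p ^ k) = 1 := by
    have h := hpowv (p ^ k)
    rw [hA, Module.End.one_apply] at h
    have h' : (ζ ^ (p ^ k) - 1) • v = 0 := by rw [sub_smul, ← h, one_smul, sub_self]
    rcases smul_eq_zero.1 h' with h' | h'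
    · exact sub_eq_zero.1 h'
    · exact absurd h' hv.2
  have hpord : p ∣ orderOf ζ := by
    obtain ⟨j, -, hj⟩ := (Nat.dvd_prime_pow hp).1 (orderOf_dvd_of_pow_eq_one hζq)
    rw [hj]
    refine dvd_pow_self p ?_
    rintro rfl
    rw [pow_zero, orderOf_eq_one_iff] at hj
    exact hζ1 hj
  have hex : ∀ a : Fin ((p - 1) / 2), ∃ w : V, A.HasEigenvector (ζ ^ ((a : ℕ) + 1) ^ 2) w := by
    intro a
    have ha := a.2
    obtain ⟨H, hinj, hH⟩ := hconj (a + 1) (by omega) (by omega)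
    refine ⟨H v, Module.End.mem_eigenspace_iff.2 ?_, ?_⟩
    · rw [← Module.End.mul_apply, hH, Module.End.mul_apply, hpowv, map_smul]
    · intro h0
      exact hv.2 (hinj (by rw [h0, map_zero]))
  choose w hw using hex
  have hinj : Function.Injective (fun a : Fin ((p - 1) / 2) => ζ ^ ((a : ℕ) + 1) ^ 2) := by
    intro a b hab
    have ha := a.2
    have hb := b.2
    have hfin : IsOfFinOrder ζ :=
      isOfFinOrder_iff_pow_eq_one.2 ⟨p ^ k, pow_pos hp.pos k, hζq⟩
    have hmod := hfin.pow_eq_pow_iff_modEq.1 hab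
    have h1 : (p : ℤ) ∣ (((b : ℕ) : ℤ) + 1) ^ 2 - (((a : ℕ) : ℤ) + 1) ^ 2 := by
      have := (Nat.modEq_iff_dvd.1 hmod)
      push_cast at this
      exact (Int.natCast_dvd_natCast.2 hpord).trans this
    rw [sq_sub_sq] at h1
    rcases (Nat.prime_iff_prime_int.1 hp).dvd_or_dvd h1 with h | h
    · have := Int.le_of_dvd (by omega) h
      omega
    · have := Int.eq_zero_of_abs_lt_dvd h (by rw [abs_lt]; omega)
      ext
      omega
  have hli := Module.End.eigenvectors_linearIndependent' A _ hinj w hw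
  simpa using hli.fintype_card_le_finrank

section Torus

variable {R : Type*} [CommRing R] {n : Type*} [Fintype n] [DecidableEq n]

/-- The diagonal matrix with entries `a` and `a⁻¹` in positions `i ≠ j`, and `1` elsewhere. -/
def diagPair {i j : n} (hij : i ≠ j) (a : Rˣ) : Matrix.SpecialLinearGroup n R :=
  ⟨Matrix.diagonal fun k => if k = i then (a : R) else if k = j then ((a⁻¹ : Rˣ) : R) else 1, by
    rw [Matrix.det_diagonal, ← Finset.mul_prod_erase _ _ (Finset.mem_univ i),
      ← Finset.mul_prod_erase _ _ (Finset.mem_erase.2 ⟨hij.symm, Finset.mem_univ j⟩),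
      Finset.prod_eq_one]
    · simp [hij.symm]
    · intro k hk
      simp only [Finset.mem_erase] at hk
      simp [hk.1, hk.2.1]⟩

theorem diagPair_coe {i j : n} (hij : i ≠ j) (a : Rˣ) :
    (diagPair hij a : Matrix n n R) = Matrix.diagonal fun k =>
      if k = i then (a : R) else if k = j then ((a⁻¹ : Rˣ) : R) else 1 := rfl

theorem diagPair_mul_transvection {i j : n} (hij : i ≠ j) (a : Rˣ) (c : R) :
    diagPair hij a * Matrix.SpecialLinearGroup.transvection hij c =
      Matrix.SpecialLinearGroup.transvection hij ((a : R) ^ 2 * c) * diagPair hij a := by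
  ext x y
  rw [Matrix.SpecialLinearGroup.coe_mul, Matrix.SpecialLinearGroup.coe_mul, diagPair_coe,
    Matrix.SpecialLinearGroup.transvection_coe, Matrix.SpecialLinearGroup.transvection_coe,
    Matrix.diagonal_mul, Matrix.mul_diagonal]
  simp only [Matrix.add_apply, Matrix.one_apply, Matrix.single_apply]
  by_cases hxy : x = y
  · subst hxy
    have : ¬ (i = x ∧ j = x) := fun h => hij (h.1.trans h.2.symm)
    simp [this]
  · by_cases h : i = x ∧ j = y
    · obtain ⟨rfl, rfl⟩ := h
      simp only [hxy, hij.symm, if_true, if_false, and_self, zero_add]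
      rw [mul_right_comm, sq, mul_assoc (a : R), Units.mul_inv, mul_one]
    · simp [h, hxy]

theorem transvection_pow {i j : n} (hij : i ≠ j) (c : R) (m : ℕ) :
    Matrix.SpecialLinearGroup.transvection hij c ^ m =
      Matrix.SpecialLinearGroup.transvection hij (m * c) := by
  induction m with
  | zero => simp
  | succ m ih =>
    rw [pow_succ, ih, ← Matrix.SpecialLinearGroup.transvection_add]
    congr 1
    push_cast
    ring

end Torus

/-- Nontrivial representations of `SL_n(ℤ/pᵏℤ)` have dimension at least `(p - 1) / 2`. -/
theorem half_le_finrank_of_representation (n p k : ℕ) [Fact p.Prime] (hk : 1 ≤ k)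
    {V : Type*} [AddCommGroup V] [Module ℂ V] [FiniteDimensional ℂ V]
    (ρ : Matrix.SpecialLinearGroup (Fin n) (ZMod (p ^ k)) →* Module.End ℂ V) (hρ : ρ ≠ 1) :
    (p - 1) / 2 ≤ Module.finrank ℂ V := by
  have hp : p.Prime := Fact.out
  have : Fact (1 < p ^ k) := ⟨Nat.one_lt_pow (by omega) hp.one_lt⟩
  have : IsLocalRing (ZMod (p ^ k)) :=
    IsLocalRing.of_surjective' (PadicInt.toZModPow (p := p) k) (ZMod.ringHom_surjective _)
  have hex : ∃ (i j : Fin n) (hij : i ≠ j) (c : ZMod (p ^ k)),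
      ρ (Matrix.SpecialLinearGroup.transvection hij c) ≠ 1 := by
    by_contra! hcon
    exact hρ (monoidHom_eq_one_of_transvection ρ hcon)
  obtain ⟨i, j, hij, c, hc⟩ := hex
  refine half_le_finrank_of_conj_sq p k hp _ ?_ hc ?_
  · rw [← map_pow, transvection_pow, ZMod.natCast_self, zero_mul,
      Matrix.SpecialLinearGroup.transvection_coeff_zero, map_one]
  · intro a ha hap
    have hcop : Nat.Coprime a (p ^ k) :=
      Nat.Coprime.pow_right _ (Nat.coprime_of_lt_prime ha.ne' hap hp).symm
    set h := diagPair hij (ZMod.unitOfCoprime a hcop) with hh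
    refine ⟨ρ h⁻¹, ?_, ?_⟩
    · refine Function.LeftInverse.injective (g := ρ h) fun v => ?_
      rw [← Module.End.mul_apply, ← map_mul, mul_inv_cancel, map_one, Module.End.one_apply]
    · rw [← map_pow, ← map_mul, ← map_mul, transvection_pow]
      congr 1
      rw [eq_inv_mul_iff_mul_eq, ← mul_assoc, hh, diagPair_mul_transvection, mul_assoc,
        mul_inv_cancel, mul_one]
      simp

section Mixing

variable {G : Type*} [Group G] [Fintype G]

/-- The matrix of convolution by `F`. -/
def convMatrix (F : G → ℝ) : Matrix G G ℂ := Matrix.of fun x y => (F (x⁻¹ * y) : ℂ)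

theorem convMatrix_gram_left_invariant (F : G → ℝ) (g x y : G) :
    ((convMatrix F).conjTranspose * convMatrix F) (g * x) (g * y) =
      ((convMatrix F).conjTranspose * convMatrix F) x y := by
  simp only [Matrix.mul_apply, Matrix.conjTranspose_apply, convMatrix, Matrix.of_apply]
  rw [← Equiv.sum_comp (Equiv.mulLeft g)]
  refine Finset.sum_congr rfl fun z _ => ?_
  simp [mul_assoc]

theorem trace_convMatrix_gram_le (F : G → ℝ) (hF : ∀ x, |F x| ≤ 1) :
    (((convMatrix F).conjTranspose * convMatrix F).trace).re ≤ (Fintype.card G : ℝ) ^ 2 := by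
  simp only [Matrix.trace, Matrix.diag, Matrix.mul_apply, Matrix.conjTranspose_apply, convMatrix,
    Matrix.of_apply, Complex.re_sum]
  calc _ ≤ ∑ _x : G, ∑ _y : G, (1 : ℝ) := by
        refine Finset.sum_le_sum fun x _ => Finset.sum_le_sum fun y _ => ?_
        simp only [Complex.star_def, Complex.conj_ofReal, ← Complex.ofReal_mul, Complex.ofReal_re]
        have := (sq_le_one_iff_abs_le_one _).2 (hF (y⁻¹ * x))
        nlinarith
    _ = _ := by simp [sq]

open scoped ComplexOrder in
theorem quadratic_form_le_of_eigenvalues_le {n : Type*} [Fintype n] [DecidableEq n]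
    {B : Matrix n n ℂ} (hB : B.IsHermitian) (c : ℝ) (hc : ∀ i, hB.eigenvalues i ≤ c)
    (v : n → ℂ) : (star v ⬝ᵥ B.mulVec v).re ≤ c * (star v ⬝ᵥ v).re := by
  have hps : ((c : ℂ) • (1 : Matrix n n ℂ) - B).PosSemidef := by
    have h1 : (Matrix.diagonal fun i => ((c - hB.eigenvalues i : ℝ) : ℂ)).PosSemidef := by
      refine Matrix.PosSemidef.diagonal fun i => ?_
      exact Complex.zero_le_real.2 (sub_nonneg.2 (hc i))
    have h2 := h1.mul_mul_conjTranspose_same (hB.eigenvectorUnitary : Matrix n n ℂ)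
    convert h2 using 1
    have h3 : (Matrix.diagonal fun i => ((c - hB.eigenvalues i : ℝ) : ℂ)) =
        (c : ℂ) • (1 : Matrix n n ℂ) - Matrix.diagonal (RCLike.ofReal ∘ hB.eigenvalues) := by
      ext i j
      by_cases hij : i = j
      · subst hij
        simp
      · simp [hij]
    have h4 : (hB.eigenvectorUnitary : Matrix n n ℂ) *
        (hB.eigenvectorUnitary : Matrix n n ℂ).conjTranspose = 1 :=
      Unitary.coe_mul_star_self hB.eigenvectorUnitary
    have h5 := hB.spectral_theorem
    rw [Unitary.conjStarAlgAut_apply] at h5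
    rw [h3, mul_sub, sub_mul]
    congr 1
    rw [Matrix.mul_smul, Matrix.smul_mul, mul_one, h4]
  have h := hps.re_dotProduct_nonneg v
  rw [Matrix.sub_mulVec, Matrix.smul_mulVec, Matrix.one_mulVec, dotProduct_sub,
    dotProduct_smul] at h
  simp only [RCLike.re_to_complex, Complex.sub_re, smul_eq_mul, Complex.re_ofReal_mul] at h
  linarith

theorem finrank_eigenspace_le_card_eigenvalues {n : Type*} [Fintype n] [DecidableEq n]
    {B : Matrix n n ℂ} (hB : B.IsHermitian) (c : ℝ) :
    Module.finrank ℂ (Module.End.eigenspace (Matrix.toLin' B) (c : ℂ)) ≤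
      (Finset.univ.filter fun i => hB.eigenvalues i = c).card := by
  refine (LinearMap.finrank_eigenspace_le _ _).trans (le_of_eq ?_)
  rw [← Polynomial.count_roots, Matrix.charpoly_toLin', hB.roots_charpoly_eq_eigenvalues,
    Multiset.count_map, ← Finset.filter_val, Finset.card_val]
  congr 1
  ext i
  simp [eq_comm]

open scoped ComplexOrder in
theorem eigenvalue_convMatrix_gram_le [DecidableEq G] (D : ℕ) (hD0 : 0 < D)
    (hD : ∀ (W : Submodule ℂ (G → ℂ)) (ρ : G →* Module.End ℂ W), ρ ≠ 1 →
      D ≤ Module.finrank ℂ W)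
    (F : G → ℝ) (hF : ∀ x, |F x| ≤ 1) (hF0 : ∑ x, F x = 0)
    (hB : ((convMatrix F).conjTranspose * convMatrix F).IsHermitian) (i : G) :
    hB.eigenvalues i ≤ (Fintype.card G : ℝ) ^ 2 / D := by
  have hD0' : (0 : ℝ) < D := by exact_mod_cast hD0
  have hnn : ∀ j, 0 ≤ hB.eigenvalues j :=
    (Matrix.posSemidef_conjTranspose_mul_self (convMatrix F)).eigenvalues_nonneg
  rcases (hnn i).eq_or_lt with h0 | hpos
  · rw [← h0]
    positivity
  set B := (convMatrix F).conjTranspose * convMatrix F with hBdef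
  set c := hB.eigenvalues i with hc
  set W := Module.End.eigenspace (Matrix.toLin' B) (c : ℂ) with hW
  have hmem : ∀ w : G → ℂ, w ∈ W ↔ ∀ x, ∑ y, B x y * w y = c * w x := by
    intro w
    rw [hW, Module.End.mem_eigenspace_iff, Matrix.toLin'_apply, funext_iff]
    rfl
  have hinv : ∀ g : G, ∀ w ∈ W, (fun x => w (g⁻¹ * x)) ∈ W := by
    intro g w hw
    rw [hmem] at hw ⊢
    intro x
    rw [← hw, ← Equiv.sum_comp (Equiv.mulLeft g)]
    refine Finset.sum_congr rfl fun y _ => ?_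
    have h := convMatrix_gram_left_invariant F g (g⁻¹ * x) y
    rw [mul_inv_cancel_left, ← hBdef] at h
    rw [Equiv.coe_mulLeft, inv_mul_cancel_left, h]
  have hconst : ∀ w ∈ W, (∀ x y, w x = w y) → w = 0 := by
    intro w hw hcon
    rw [hmem] at hw
    have hz : ∀ x, ∑ y, B x y = 0 := by
      intro x
      simp only [hBdef, Matrix.mul_apply, convMatrix, Matrix.of_apply]
      rw [Finset.sum_comm]
      refine Finset.sum_eq_zero fun z _ => ?_
      have h : ∑ y, F (z⁻¹ * y) = 0 := by
        rw [← hF0]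
        exact Equiv.sum_comp (Equiv.mulLeft z⁻¹) F
      rw [← Finset.mul_sum, ← Complex.ofReal_sum, h, Complex.ofReal_zero, mul_zero]
    ext x
    have h1 := hw x
    rw [Finset.sum_congr rfl fun y _ => by rw [hcon y x], ← Finset.sum_mul, hz, zero_mul] at h1
    have hc0 : (c : ℂ) ≠ 0 := by exact_mod_cast hpos.ne'
    simpa [hc0] using h1.symm
  let ρ : G →* Module.End ℂ W :=
    { toFun := fun g =>
        { toFun := fun w => ⟨fun x => (w : G → ℂ) (g⁻¹ * x), hinv g w w.2⟩
          map_add' := fun _ _ => rfl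
          map_smul' := fun _ _ => rfl }
      map_one' := by
        ext w x
        simp
      map_mul' := fun g h => by
        ext w x
        simp [mul_assoc] }
  have hρ : ρ ≠ 1 := by
    intro h1
    have hvec : ((hB.eigenvectorBasis i : EuclideanSpace ℂ G) : G → ℂ) ∈ W := by
      rw [hW, Module.End.mem_eigenspace_iff, Matrix.toLin'_apply]
      exact hB.mulVec_eigenvectorBasis i
    have hz := hconst _ hvec fun x y => by
      have h2 := congrArg (fun f : G →* Module.End ℂ W =>
        ((f (y * x⁻¹)) ⟨_, hvec⟩ : W).1 y) h1
      simpa [ρ] using h2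
    apply (hB.eigenvectorBasis.toBasis.ne_zero i)
    rw [OrthonormalBasis.coe_toBasis]
    ext x
    exact congrFun hz x
  have hle := (hD W ρ hρ).trans (finrank_eigenspace_le_card_eigenvalues hB c)
  have htr : ∑ j, hB.eigenvalues j ≤ (Fintype.card G : ℝ) ^ 2 := by
    have h1 := trace_convMatrix_gram_le F hF
    rw [← hBdef, hB.trace_eq_sum_eigenvalues] at h1
    simpa using h1
  rw [le_div_iff₀ hD0']
  calc c * D ≤ c * (Finset.univ.filter fun j => hB.eigenvalues j = c).card := by
        gcongr
    _ = ∑ j ∈ Finset.univ.filter (fun j => hB.eigenvalues j = c), hB.eigenvalues j := by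
        rw [Finset.sum_congr rfl fun j hj => (Finset.mem_filter.1 hj).2, Finset.sum_const,
          nsmul_eq_mul, mul_comm]
    _ ≤ ∑ j, hB.eigenvalues j :=
        Finset.sum_le_sum_of_subset_of_nonneg (Finset.filter_subset _ _) fun j _ _ => hnn j
    _ ≤ _ := htr

/-- Mixing in a quasirandom group: if every nontrivial representation of `G` on a space of
functions has dimension at least `D`, then convolution by a bounded function of mean zero has
small norm. -/
theorem sq_sum_conv_le [DecidableEq G] (D : ℕ) (hD0 : 0 < D)
    (hD : ∀ (W : Submodule ℂ (G → ℂ)) (ρ : G →* Module.End ℂ W), ρ ≠ 1 →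
      D ≤ Module.finrank ℂ W)
    (F : G → ℝ) (hF : ∀ x, |F x| ≤ 1) (hF0 : ∑ x, F x = 0) (a b : G → ℝ) :
    (∑ x, a x * ∑ y, F (x⁻¹ * y) * b y) ^ 2 ≤
      (Fintype.card G : ℝ) ^ 2 / D * (∑ x, a x ^ 2) * ∑ y, b y ^ 2 := by
  have hB := Matrix.isHermitian_conjTranspose_mul_self (convMatrix F)
  have h := quadratic_form_le_of_eigenvalues_le hB _
    (eigenvalue_convMatrix_gram_le D hD0 hD F hF hF0 hB) (fun y => (b y : ℂ))
  have h1 : (star (fun y => (b y : ℂ)) ⬝ᵥ (fun y => (b y : ℂ))).re = ∑ y, b y ^ 2 := by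
    simp [dotProduct, sq]
  have h2 : (star (fun y => (b y : ℂ)) ⬝ᵥ
      ((convMatrix F).conjTranspose * convMatrix F).mulVec (fun y => (b y : ℂ))).re =
      ∑ x, (∑ y, F (x⁻¹ * y) * b y) ^ 2 := by
    have h3 : (convMatrix F).mulVec (fun y => (b y : ℂ)) =
        fun x => ((∑ y, F (x⁻¹ * y) * b y : ℝ) : ℂ) := by
      ext x
      simp [convMatrix, Matrix.mulVec, dotProduct]
    rw [← Matrix.mulVec_mulVec, Matrix.dotProduct_mulVec, Matrix.vecMul_conjTranspose, star_star,
      h3]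
    simp only [dotProduct, Pi.star_apply, Complex.star_def, Complex.conj_ofReal,
      ← Complex.ofReal_mul, ← Complex.ofReal_sum, Complex.ofReal_re, sq]
  rw [h1, h2] at h
  calc _ ≤ (∑ x, a x ^ 2) * ∑ x, (∑ y, F (x⁻¹ * y) * b y) ^ 2 :=
        Finset.sum_mul_sq_le_sq_mul_sq _ _ _
    _ ≤ (∑ x, a x ^ 2) * ((Fintype.card G : ℝ) ^ 2 / D * ∑ y, b y ^ 2) := by
        refine mul_le_mul_of_nonneg_left h (Finset.sum_nonneg fun x _ => sq_nonneg _)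
    _ = _ := by ring

end Mixing


section FiniteGroup

variable {G : Type*} [Group G] [Fintype G] [DecidableEq G]

omit [DecidableEq G] in
theorem mul_ncard_le_ncard_bdry {T : Set G} {ε : ℝ} (h : ε ≤ cheeger G T) (A : Set G)
    (hA : A.Nonempty) (hA2 : 2 * A.ncard ≤ Nat.card G) :
    ε * A.ncard ≤ (bdry A T).ncard := by
  have hpos : (0 : ℝ) < A.ncard := by exact_mod_cast (Set.ncard_pos A.toFinite).2 hA
  rw [← le_div_iff₀ hpos]
  refine h.trans (csInf_le ⟨0, ?_⟩ ⟨A, hA, hA2, rfl⟩)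
  rintro r ⟨A, -, -, rfl⟩
  positivity

theorem mul_card_le_sum_card_escape {ι : Type*} (S : Finset ι) (q : ι → G) {ε : ℝ}
    (h : ε ≤ cheeger G (q '' ↑S)) (A : Finset G) (hA2 : 2 * A.card ≤ Fintype.card G) :
    ε * A.card ≤ ∑ γ ∈ S, ((A.filter fun x => q γ * x ∉ A).card : ℝ) := by
  rcases A.eq_empty_or_nonempty with rfl | hA
  · simp
  have h1 := mul_ncard_le_ncard_bdry h (A : Set G) (by simpa using hA)
    (by rwa [Set.ncard_coe_finset, Nat.card_eq_fintype_card])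
  rw [Set.ncard_coe_finset] at h1
  refine h1.trans ?_
  have h2 : bdry (A : Set G) (q '' ↑S) ⊆
      ((S.biUnion fun γ => A.filter fun x => q γ * x ∉ A : Finset G) : Set G) := by
    rintro x ⟨hx, hx'⟩
    push Not at hx'
    obtain ⟨_, ⟨γ, hγ, rfl⟩, hγx⟩ := hx'
    simp only [Finset.coe_biUnion, Set.mem_iUnion]
    exact ⟨γ, hγ, by simpa using ⟨hx, hγx⟩⟩
  have h3 := (Set.ncard_le_ncard h2 (Finset.finite_toSet _)).trans
    ((Set.ncard_coe_finset _).le.trans Finset.card_biUnion_le)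
  calc _ ≤ ((∑ γ ∈ S, (A.filter fun x => q γ * x ∉ A).card : ℕ) : ℝ) := Nat.cast_le.2 h3
    _ = _ := Nat.cast_sum _ _

/-- The set of pairs on which `f` changes under the diagonal translation by `g`. -/
def changeSet (f : G × G → Fin 2) (g : G) : Finset (G × G) :=
  Finset.univ.filter fun w => f w ≠ f (g * w.1, g * w.2)

/-- A function on `G × G` that is almost invariant under diagonal translations is close to an
invariant one. -/
theorem exists_invariant_near {ι : Type*} (S : Finset ι) (q : ι → G) {ε : ℝ}
    (h : ε ≤ cheeger G (q '' ↑S)) (f : G × G → Fin 2) :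
    ∃ F : G → Fin 2,
      ε * ((Finset.univ.filter fun w : G × G => f w ≠ F (w.1⁻¹ * w.2)).card : ℝ) ≤
        ∑ γ ∈ S, ((changeSet f (q γ)).card : ℝ) := by
  have hfib : ∀ z : G, ∃ c : Fin 2, 2 * (Finset.univ.filter fun x : G => f (x, x * z) ≠ c).card ≤
      Fintype.card G := by
    intro z
    have h1 := Finset.card_filter_add_card_filter_not (s := (Finset.univ : Finset G))
      (fun x => f (x, x * z) ≠ 0)
    have h2 : (Finset.univ.filter fun x : G => ¬ f (x, x * z) ≠ 0) =
        Finset.univ.filter fun x : G => f (x, x * z) ≠ 1 := by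
      ext x
      simp only [Finset.mem_filter, Finset.mem_univ, true_and]
      generalize f (x, x * z) = t
      fin_cases t <;> simp
    rw [h2, Finset.card_univ] at h1
    by_cases h3 : 2 * (Finset.univ.filter fun x : G => f (x, x * z) ≠ 0).card ≤ Fintype.card G
    · exact ⟨0, h3⟩
    · exact ⟨1, by omega⟩
  choose F hF using hfib
  have hsum : ∀ P : G × G → Prop, ∀ _ : DecidablePred P,
      ((Finset.univ.filter P).card : ℝ) =
        ∑ z : G, ((Finset.univ.filter fun x : G => P (x, x * z)).card : ℝ) := by
    intro P _
    have h1 : ∀ z : G, ((Finset.univ.filter fun x : G => P (x, x * z)).card : ℝ) =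
        ∑ x : G, if P (x, x * z) then (1 : ℝ) else 0 := fun z => by simp
    have h2 : ((Finset.univ.filter P).card : ℝ) = ∑ w : G × G, if P w then (1 : ℝ) else 0 := by
      simp
    rw [Finset.sum_congr rfl fun z _ => h1 z, h2, Finset.sum_comm, Fintype.sum_prod_type]
    refine Finset.sum_congr rfl fun x _ => ?_
    rw [← Equiv.sum_comp (Equiv.mulLeft x)]
    rfl
  refine ⟨F, ?_⟩
  rw [hsum, Finset.mul_sum]
  simp only [changeSet]
  rw [Finset.sum_congr rfl fun γ _ => hsum _ _, Finset.sum_comm]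
  refine Finset.sum_le_sum fun z _ => ?_
  simp only [inv_mul_cancel_left]
  refine (mul_card_le_sum_card_escape S q h _ (hF z)).trans (Finset.sum_le_sum fun γ _ => ?_)
  refine Nat.cast_le.2 (Finset.card_le_card fun x => ?_)
  simp only [Finset.mem_filter, Finset.mem_univ, true_and, mul_assoc, not_not]
  rintro ⟨h1, h2⟩ h3
  exact h1 (h3.trans h2)

/-- Step functions with few steps do not correlate with mean-zero convolution kernels. -/
theorem abs_sum_step_mul_le (D : ℕ) (hD0 : 0 < D)
    (hD : ∀ (W : Submodule ℂ (G → ℂ)) (ρ : G →* Module.End ℂ W), ρ ≠ 1 →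
      D ≤ Module.finrank ℂ W)
    (F : G → ℝ) (hF : ∀ x, |F x| ≤ 1) (hF0 : ∑ x, F x = 0)
    (N : ℕ) (hN : 100 * N ^ 2 ≤ D) (g h : G → Fin N) (φ : Fin N × Fin N → ℝ)
    (hφ : ∀ i, |φ i| ≤ 1) :
    |∑ w : G × G, φ (g w.1, h w.2) * F (w.1⁻¹ * w.2)| ≤ (Fintype.card G : ℝ) ^ 2 / 10 := by
  set n : ℝ := ((Fintype.card G : ℕ) : ℝ) with hn
  have hD0' : (0 : ℝ) < D := by exact_mod_cast hD0
  set A : Fin N → ℝ := fun i => ∑ x, if g x = i then (1 : ℝ) else 0 with hA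
  set B : Fin N → ℝ := fun j => ∑ y, if h y = j then (1 : ℝ) else 0 with hB
  have hA0 : ∀ i, 0 ≤ A i := fun i => Finset.sum_nonneg fun x _ => by split_ifs <;> norm_num
  have hB0 : ∀ i, 0 ≤ B i := fun i => Finset.sum_nonneg fun x _ => by split_ifs <;> norm_num
  have hAs : ∑ i, A i = n := by
    rw [hA, Finset.sum_comm]
    simp [hn]
  have hBs : ∑ i, B i = n := by
    rw [hB, Finset.sum_comm]
    simp [hn]
  set T : Fin N × Fin N → ℝ := fun k =>
    ∑ x, (if g x = k.1 then (1 : ℝ) else 0) * ∑ y, F (x⁻¹ * y) * (if h y = k.2 then (1 : ℝ) else 0)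
    with hT
  have hdecomp : ∑ w : G × G, φ (g w.1, h w.2) * F (w.1⁻¹ * w.2) = ∑ k, φ k * T k := by
    have h1 : ∀ w : G × G, φ (g w.1, h w.2) * F (w.1⁻¹ * w.2) = ∑ k : Fin N × Fin N,
        φ k * ((if g w.1 = k.1 then (1 : ℝ) else 0) *
          (F (w.1⁻¹ * w.2) * (if h w.2 = k.2 then (1 : ℝ) else 0))) := by
      intro w
      rw [Finset.sum_eq_single (g w.1, h w.2)]
      · simp
      · rintro ⟨i, j⟩ - hne
        by_cases hi : g w.1 = i <;> by_cases hj : h w.2 = j <;> simp [hi, hj]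
        exact absurd (by rw [hi, hj]) hne
      · simp
    rw [Finset.sum_congr rfl fun w _ => h1 w, Finset.sum_comm]
    refine Finset.sum_congr rfl fun k _ => ?_
    rw [← Finset.mul_sum, Fintype.sum_prod_type, hT]
    simp only [Finset.mul_sum]
  have hTle : ∀ k, |T k| ≤ n / Real.sqrt D * ((A k.1 + B k.2) / 2) := by
    intro k
    refine abs_le_of_sq_le_sq ?_ (by have := hA0 k.1; have := hB0 k.2; positivity)
    have h1 := sq_sum_conv_le D hD0 hD F hF hF0 (fun x => if g x = k.1 then (1 : ℝ) else 0)
      (fun y => if h y = k.2 then (1 : ℝ) else 0)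
    simp only [ite_pow, one_pow, zero_pow two_ne_zero] at h1
    refine h1.trans ?_
    rw [mul_pow, div_pow, Real.sq_sqrt hD0'.le, mul_assoc]
    gcongr
    nlinarith [sq_nonneg (A k.1 - B k.2)]
  have hND : (10 * N : ℝ) ≤ Real.sqrt D := by
    refine Real.le_sqrt_of_sq_le ?_
    have : ((100 * N ^ 2 : ℕ) : ℝ) ≤ D := by exact_mod_cast hN
    push_cast at this
    linarith
  rw [hdecomp]
  calc |∑ k, φ k * T k| ≤ ∑ k, |φ k * T k| := Finset.abs_sum_le_sum_abs _ _
    _ ≤ ∑ k : Fin N × Fin N, n / Real.sqrt D * ((A k.1 + B k.2) / 2) := by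
        refine Finset.sum_le_sum fun k _ => ?_
        rw [abs_mul]
        exact (mul_le_of_le_one_left (abs_nonneg _) (hφ k)).trans (hTle k)
    _ = n / Real.sqrt D * (N * n) := by
        rw [← Finset.mul_sum, ← Finset.sum_div, Finset.sum_add_distrib, Fintype.sum_prod_type,
          Fintype.sum_prod_type_right]
        simp only [Finset.sum_const, Finset.card_univ, Fintype.card_fin, nsmul_eq_mul,
          ← Finset.mul_sum, hAs, hBs]
        ring
    _ ≤ n ^ 2 / 10 := by
        have hs : 0 < Real.sqrt D := Real.sqrt_pos.2 hD0'
        rw [div_mul_eq_mul_div, div_le_div_iff₀ hs (by norm_num)]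
        nlinarith [mul_le_mul_of_nonneg_left hND (sq_nonneg n)]

/-- A step function with few steps on a quasirandom group with a spectral gap is not almost
invariant under the diagonal action while being balanced. -/
theorem step_function_not_almost_invariant [Nontrivial G] (D : ℕ) (hD0 : 0 < D)
    (hD : ∀ (W : Submodule ℂ (G → ℂ)) (ρ : G →* Module.End ℂ W), ρ ≠ 1 →
      D ≤ Module.finrank ℂ W)
    {ι : Type*} (S : Finset ι) (q : ι → G) {ε : ℝ} (hε : 0 < ε)
    (hch : ε ≤ cheeger G (q '' ↑S))
    (N : ℕ) (hN : 100 * N ^ 2 ≤ D) (g h : G → Fin N) (φ : Fin N × Fin N → Fin 2) :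
    ∃ γ ∈ S, ∃ i j : Fin 2, ε / (32 * S.card) ≤
      |(if i = j then 1 / 2 else 0) -
        ((Finset.univ.filter fun w : G × G => φ (g w.1, h w.2) = i ∧
          φ (g (q γ * w.1), h (q γ * w.2)) = j).card : ℝ) / (Fintype.card G : ℝ) ^ 2| := by
  by_contra! hcon
  set n : ℝ := ((Fintype.card G : ℕ) : ℝ) with hn
  have hn0 : 0 < n := by rw [hn]; exact_mod_cast Fintype.card_pos
  set f : G × G → Fin 2 := fun w => φ (g w.1, h w.2) with hf
  set δ := ε / (32 * S.card) with hδ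
  set M : ι → Fin 2 → Fin 2 → ℝ := fun γ i j => ((Finset.univ.filter fun w : G × G => f w = i ∧
          f (q γ * w.1, q γ * w.2) = j).card : ℝ) with hM
  have hcon' : ∀ γ ∈ S, ∀ i j, |(if i = j then 1 / 2 else 0) - M γ i j / n ^ 2| < δ := hcon
  have htwo : 2 ≤ Fintype.card G := Fintype.one_lt_card
  have hε1 : ε ≤ 1 := by
    have h1 := mul_ncard_le_ncard_bdry hch {1} (Set.singleton_nonempty _)
      (by simpa [Nat.card_eq_fintype_card] using htwo)
    have h2 : (bdry ({1} : Set G) (q '' ↑S)).ncard ≤ ({1} : Set G).ncard :=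
      Set.ncard_le_ncard (fun x hx => hx.1)
    rw [Set.ncard_singleton] at h1 h2
    have h3 : ((bdry ({1} : Set G) (q '' ↑S)).ncard : ℝ) ≤ 1 := by exact_mod_cast h2
    rw [Nat.cast_one, mul_one] at h1
    exact h1.trans h3
  have hS : S.Nonempty := by
    by_contra hS
    rw [Finset.not_nonempty_iff_eq_empty] at hS
    have h1 := mul_card_le_sum_card_escape S q hch {1} (by simpa using htwo)
    rw [hS] at h1
    simp at h1
    linarith
  have hS1 : (1 : ℝ) ≤ S.card := by exact_mod_cast hS.card_pos
  have hδ1 : δ ≤ 1 / 32 := by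
    rw [hδ, div_le_div_iff₀ (by positivity) (by norm_num)]
    linarith
  have hSδ : S.card * δ = ε / 32 := by
    rw [hδ]
    field_simp
  obtain ⟨F, hF⟩ := exists_invariant_near S q hch f
  set E : ℝ := ((Finset.univ.filter fun w : G × G => f w ≠ F (w.1⁻¹ * w.2)).card : ℝ) with hE
  have hchange : ∀ γ ∈ S, ((changeSet f (q γ)).card : ℝ) ≤ 2 * δ * n ^ 2 := by
    intro γ hγ
    have h1 : ((changeSet f (q γ)).card : ℝ) ≤ M γ 0 1 + M γ 1 0 := by
      rw [hM]
      simp only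
      rw [← Nat.cast_add]
      refine Nat.cast_le.2 (le_trans (Finset.card_le_card ?_) (Finset.card_union_le _ _))
      intro w
      simp only [changeSet, Finset.mem_union, Finset.mem_filter, Finset.mem_univ, true_and]
      generalize f w = a
      generalize f (q γ * w.1, q γ * w.2) = b
      fin_cases a <;> fin_cases b <;> simp
    have h2 := (abs_lt.1 (hcon' γ hγ 0 1)).1
    have h3 := (abs_lt.1 (hcon' γ hγ 1 0)).1
    simp only [Fin.isValue, zero_ne_one, one_ne_zero, if_false, zero_sub, neg_lt_neg_iff] at h2 h3
    rw [div_lt_iff₀ (by positivity)] at h2 h3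
    linarith
  have hE16 : E ≤ n ^ 2 / 16 := by
    have h1 := hF.trans (Finset.sum_le_sum hchange)
    rw [Finset.sum_const, nsmul_eq_mul] at h1
    have h2 : ε * E ≤ ε * (n ^ 2 / 16) := by
      calc _ ≤ _ := h1
        _ = 2 * (S.card * δ) * n ^ 2 := by ring
        _ = _ := by rw [hSδ]; ring
    exact le_of_mul_le_mul_left h2 hε
  set r : Fin 2 → ℝ := fun i => if i = 1 then 1 else 0 with hr
  have hr01 : ∀ i, 0 ≤ r i ∧ r i ≤ 1 := fun i => by
    simp only [hr]
    split_ifs <;> norm_num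
  set a : ℝ := ∑ w, r (f w) with ha
  have ha2 : |a - n ^ 2 / 2| ≤ n ^ 2 / 16 := by
    obtain ⟨γ, hγ⟩ := hS
    have h1 : a = M γ 1 1 + M γ 1 0 := by
      simp only [ha, hM, hr, Finset.card_filter, Nat.cast_sum, ← Finset.sum_add_distrib]
      refine Finset.sum_congr rfl fun w _ => ?_
      generalize f w = a
      generalize f (q γ * w.1, q γ * w.2) = b
      fin_cases a <;> fin_cases b <;> simp
    have h2 := (abs_lt.1 (hcon' γ hγ 1 1))
    have h3 := (abs_lt.1 (hcon' γ hγ 1 0))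
    simp only [Fin.isValue, one_ne_zero, if_true, if_false, zero_sub] at h2 h3
    have h4 : M γ 1 1 / n ^ 2 * n ^ 2 = M γ 1 1 := by field_simp
    have h5 : M γ 1 0 / n ^ 2 * n ^ 2 = M γ 1 0 := by field_simp
    have hn2 : 0 < n ^ 2 := by positivity
    rw [h1, ← h4, ← h5, abs_le]
    constructor <;> nlinarith
  set b : ℝ := ∑ z, r (F z) with hb
  have hbsum : ∑ w : G × G, r (F (w.1⁻¹ * w.2)) = n * b := by
    rw [Fintype.sum_prod_type]
    have : ∀ x : G, ∑ y, r (F (x⁻¹ * y)) = b := fun x =>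
      Equiv.sum_comp (Equiv.mulLeft x⁻¹) fun y => r (F y)
    simp [this, hn]
  have hEsum : E = a + n * b - 2 * ∑ w : G × G, r (f w) * r (F (w.1⁻¹ * w.2)) := by
    rw [← hbsum, ha, Finset.mul_sum, ← Finset.sum_add_distrib, ← Finset.sum_sub_distrib, hE,
      Finset.card_filter, Nat.cast_sum]
    refine Finset.sum_congr rfl fun w _ => ?_
    simp only [hr]
    generalize f w = s
    generalize F (w.1⁻¹ * w.2) = t
    fin_cases s <;> fin_cases t <;> norm_num
  have hEab : |a - n * b| ≤ E := by
    rw [← hbsum, ha, ← Finset.sum_sub_distrib, hE, Finset.card_filter, Nat.cast_sum]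
    refine (Finset.abs_sum_le_sum_abs _ _).trans (Finset.sum_le_sum fun w _ => ?_)
    simp only [hr]
    generalize f w = s
    generalize F (w.1⁻¹ * w.2) = t
    fin_cases s <;> fin_cases t <;> norm_num
  have hb0 : 0 ≤ b := Finset.sum_nonneg fun z _ => (hr01 _).1
  have hbn : b ≤ n := by
    rw [hb, hn, ← Finset.card_univ, ← nsmul_one, ← Finset.sum_const]
    exact Finset.sum_le_sum fun z _ => (hr01 _).2
  have hmix := abs_sum_step_mul_le D hD0 hD (fun z => r (F z) - b / n)
    (fun z => by
      have h1 := hr01 (F z)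
      have h2 : 0 ≤ b / n := by positivity
      have h3 : b / n ≤ 1 := (div_le_one hn0).2 hbn
      rw [abs_le]
      constructor <;> linarith)
    (by
      rw [Finset.sum_sub_distrib, Finset.sum_const, Finset.card_univ, nsmul_eq_mul, ← hn]
      field_simp
      rw [← hb]
      ring)
    N hN g h (fun k => r (φ k)) (fun k => by rw [abs_of_nonneg (hr01 _).1]; exact (hr01 _).2)
  have hexp : ∑ w : G × G, r (φ (g w.1, h w.2)) * (r (F (w.1⁻¹ * w.2)) - b / n) =
      (∑ w : G × G, r (f w) * r (F (w.1⁻¹ * w.2))) - a * (b / n) := by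
    rw [ha, Finset.sum_mul, ← Finset.sum_sub_distrib]
    exact Finset.sum_congr rfl fun w _ => mul_sub _ _ _
  rw [hexp, ← hn] at hmix
  set c : ℝ := ∑ w : G × G, r (f w) * r (F (w.1⁻¹ * w.2)) with hc
  clear_value a b c E n
  have hn2 : 0 < n ^ 2 := by positivity
  obtain ⟨a', rfl⟩ : ∃ a', a = n ^ 2 * a' := ⟨a / n ^ 2, by field_simp⟩
  obtain ⟨b', rfl⟩ : ∃ b', b = n * b' := ⟨b / n, by field_simp⟩
  rw [mul_div_cancel_left₀ b' hn0.ne'] at hmix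
  obtain ⟨e, rfl⟩ : ∃ e, E = n ^ 2 * e := ⟨E / n ^ 2, by field_simp⟩
  obtain rfl : c = n ^ 2 * ((a' + b' - e) / 2) := by linarith
  have h1 : e ≤ 1 / 16 := le_of_mul_le_mul_left (by linarith) hn2
  have hscale : ∀ x y : ℝ, |n ^ 2 * x| ≤ n ^ 2 * y → |x| ≤ y := fun x y hxy => by
    rw [abs_mul, abs_of_pos hn2] at hxy
    exact le_of_mul_le_mul_left hxy hn2
  have h2 : |a' - b'| ≤ e := hscale _ _ <| by
    rwa [show n ^ 2 * (a' - b') = n ^ 2 * a' - n * (n * b') by ring]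
  have h3 : |a' - 1 / 2| ≤ 1 / 16 := hscale _ _ <| by
    rwa [show n ^ 2 * (a' - 1 / 2) = n ^ 2 * a' - n ^ 2 / 2 by ring, mul_one_div]
  have h4 : |(a' + b' - e) / 2 - a' * b'| ≤ 1 / 10 := hscale _ _ <| by
    rwa [mul_sub, ← mul_assoc, mul_one_div]
  have h5 := (abs_le.1 h4).2
  obtain ⟨h6, h7⟩ := abs_le.1 h3
  obtain ⟨h8, h9⟩ := abs_le.1 h2
  nlinarith [mul_nonneg (sub_nonneg.2 h7) (sub_nonneg.2 (by linarith : b' - 1 / 2 ≤ 1 / 8)),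
    mul_nonneg (by linarith : (0 : ℝ) ≤ 1 / 16 + (a' - 1 / 2))
      (by linarith : (0 : ℝ) ≤ 1 / 8 + (b' - 1 / 2))]

end FiniteGroup

theorem specialLinearGroup_map_surjective {R T n : Type*} [CommRing R] [CommRing T] [Fintype n]
    [DecidableEq n] (f : R →+* T) [IsLocalHom f] (hf : Function.Surjective f) :
    Function.Surjective
      (Matrix.SpecialLinearGroup.map f : Matrix.SpecialLinearGroup n R → _) := by
  intro M
  rcases isEmpty_or_nonempty n with hn | ⟨⟨i⟩⟩
  · exact ⟨1, Subsingleton.elim _ _⟩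
  choose L hL using fun i j => hf (M i j)
  have hLM : f.mapMatrix (Matrix.of L) = M := by
    ext i j
    exact hL i j
  have hdet : f (Matrix.of L).det = 1 := by
    rw [RingHom.map_det, hLM, M.det_coe]
  obtain ⟨u, hu⟩ : IsUnit (Matrix.of L).det := IsUnit.of_map f _ (by rw [hdet]; exact isUnit_one)
  have hfu : f (u⁻¹ : Rˣ) = 1 := by
    have h1 : f (u⁻¹ : Rˣ) * f u = 1 := by rw [← map_mul, Units.inv_mul, map_one]
    rwa [hu, hdet, mul_one] at h1
  refine ⟨⟨(Matrix.of L).updateRow i ((u⁻¹ : Rˣ) • L i), ?_⟩, ?_⟩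
  · have h1 := Matrix.det_updateRow_smul (Matrix.of L) i ((u⁻¹ : Rˣ) : R) (L i)
    have h2 : (Matrix.of L).updateRow i (L i) = Matrix.of L := Matrix.updateRow_eq_self _ _
    rw [h2, ← hu, Units.inv_mul] at h1
    exact h1
  · ext k l
    change f ((Matrix.of L).updateRow i ((u⁻¹ : Rˣ) • L i) k l) = M k l
    rw [Matrix.updateRow_apply]
    split_ifs with hk
    · subst hk
      rw [Pi.smul_apply, Units.smul_def, smul_eq_mul, map_mul, hfu, one_mul, hL]
    · exact hL k l

section Cylinder

variable (d p : ℕ) [Fact p.Prime]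

/-- Reduction modulo `p ^ k` on `SL_d(ℤ_p)`. -/
noncomputable def redP (k : ℕ) : SLp d p →* SLmod d (p ^ k) :=
  Matrix.SpecialLinearGroup.map (PadicInt.toZModPow k)

variable {d p}

theorem redP_surjective {k : ℕ} (hk : 1 ≤ k) : Function.Surjective (redP d p k) := by
  have hp : 1 < p := (Fact.out : p.Prime).one_lt
  have : Fact (1 < p ^ k) := ⟨Nat.one_lt_pow (by omega) hp⟩
  have hs : Function.Surjective (PadicInt.toZModPow k : ℤ_[p] →+* ZMod (p ^ k)) :=
    ZMod.ringHom_surjective _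
  have := IsLocalHom.of_surjective _ hs
  exact specialLinearGroup_map_surjective _ hs

theorem redP_embZp (k : ℕ) (γ : Matrix.SpecialLinearGroup (Fin d) ℤ) :
    redP d p k (embZp d p γ) = redZ d (p ^ k) γ := by
  ext i j
  change PadicInt.toZModPow k (Int.castRingHom ℤ_[p] (γ i j)) =
    Int.castRingHom (ZMod (p ^ k)) (γ i j)
  simp

theorem redP_eq_iff {k : ℕ} {x y : SLp d p} :
    redP d p k x = redP d p k y ↔ ∀ i j, ‖x i j - y i j‖ ≤ (p : ℝ) ^ (-k : ℤ) := by
  rw [Matrix.SpecialLinearGroup.ext_iff]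
  refine forall_congr' fun i => forall_congr' fun j => ?_
  change PadicInt.toZModPow k (x i j) = PadicInt.toZModPow k (y i j) ↔ _
  rw [PadicInt.norm_le_pow_iff_mem_span_pow, ← PadicInt.ker_toZModPow, RingHom.mem_ker, map_sub,
    sub_eq_zero]

theorem redP_eq_of_le {k l : ℕ} (hkl : k ≤ l) {x y : SLp d p}
    (h : redP d p l x = redP d p l y) : redP d p k x = redP d p k y := by
  rw [redP_eq_iff] at h ⊢
  refine fun i j => (h i j).trans ?_
  have hp : (1 : ℝ) ≤ p := by exact_mod_cast (Fact.out : p.Prime).one_lt.le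
  exact zpow_le_zpow_right₀ hp (by omega)

theorem continuous_entry (i j : Fin d) : Continuous fun x : SLp d p => x i j :=
  (continuous_apply j).comp ((continuous_apply i).comp continuous_subtype_val)

theorem isOpen_redP_fiber (k : ℕ) (a : SLp d p) :
    IsOpen {x : SLp d p | redP d p k x = redP d p k a} := by
  have h : {x : SLp d p | redP d p k x = redP d p k a} =
      ⋂ i, ⋂ j, (fun x : SLp d p => x i j) ⁻¹' Metric.closedBall (a i j) ((p : ℝ) ^ (-k : ℤ)) := by
    ext x
    simp only [Set.mem_ofPred_eq, redP_eq_iff, Set.mem_iInter, Set.mem_preimage,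
      Metric.mem_closedBall, dist_eq_norm]
  have hp : (0 : ℝ) < p := by exact_mod_cast (Fact.out : p.Prime).pos
  rw [h]
  refine isOpen_iInter_of_finite fun i => isOpen_iInter_of_finite fun j => ?_
  exact (IsUltrametricDist.isOpen_closedBall _ (by positivity)).preimage (continuous_entry i j)

variable (d p) in
/-- The sets that are unions of fibres of the reduction modulo some `p ^ k`. -/
def cylinders : Set (Set (SLp d p)) :=
  {s | ∃ k, ∀ x y, redP d p k x = redP d p k y → x ∈ s → y ∈ s}

theorem isOpen_of_mem_cylinders {s : Set (SLp d p)} (hs : s ∈ cylinders d p) : IsOpen s := by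
  obtain ⟨k, hk⟩ := hs
  refine isOpen_iff_forall_mem_open.2 fun a ha =>
    ⟨{x | redP d p k x = redP d p k a}, fun x hx => hk a x hx.symm ha, isOpen_redP_fiber k a, rfl⟩

theorem isSetRing_cylinders : IsSetRing (cylinders d p) where
  empty_mem := ⟨0, fun _ _ _ h => h⟩
  union_mem := by
    rintro s t ⟨k, hk⟩ ⟨l, hl⟩
    refine ⟨max k l, fun x y hxy => Or.imp (hk x y ?_) (hl x y ?_)⟩
    · exact redP_eq_of_le (le_max_left _ _) hxy
    · exact redP_eq_of_le (le_max_right _ _) hxy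
  sdiff_mem := by
    rintro s t ⟨k, hk⟩ ⟨l, hl⟩
    refine ⟨max k l, fun x y hxy => And.imp (hk x y ?_) (mt (hl y x ?_))⟩
    · exact redP_eq_of_le (le_max_left _ _) hxy
    · exact redP_eq_of_le (le_max_right _ _) hxy.symm

theorem isTopologicalBasis_cylinders : TopologicalSpace.IsTopologicalBasis (cylinders d p) := by
  refine TopologicalSpace.isTopologicalBasis_of_isOpen_of_nhds
    (fun s hs => isOpen_of_mem_cylinders hs) fun a U ha hU => ?_
  obtain ⟨V, hV, rfl⟩ : ∃ V : Set (Fin d → Fin d → ℤ_[p]), IsOpen V ∧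
      (fun x : SLp d p => (x.1 : Fin d → Fin d → ℤ_[p])) ⁻¹' V = U := isOpen_induced_iff.1 hU
  obtain ⟨r, hr, hrV⟩ := Metric.isOpen_iff.1 hV (a.1 : Fin d → Fin d → ℤ_[p]) ha
  obtain ⟨k, hk⟩ := PadicInt.exists_pow_neg_lt p hr
  refine ⟨{x | redP d p k x = redP d p k a}, ⟨k, fun x y hxy hx => hxy.symm.trans hx⟩, rfl,
    fun x hx => hrV ?_⟩
  refine Metric.mem_ball.2 ((dist_pi_lt_iff hr).2 fun i => (dist_pi_lt_iff hr).2 fun j => ?_)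
  change dist (x i j) (a i j) < r
  rw [dist_eq_norm]
  exact (redP_eq_iff.1 hx i j).trans_lt hk

instance : SecondCountableTopology (SLp d p) :=
  inferInstanceAs (SecondCountableTopology {A : Fin d → Fin d → ℤ_[p] // Matrix.det A = 1})

/-- Finitely valued measurable functions on `SL_d(ℤ_p)` are approximated by functions of a
reduction modulo `p ^ k`. -/
theorem exists_redP_approx [MeasurableSpace (SLp d p)] [BorelSpace (SLp d p)]
    (μ : Measure (SLp d p)) [IsFiniteMeasure μ] {N : ℕ} (g : SLp d p → Fin N) (hg : Measurable g)
    {η : ℝ} (hη : 0 < η) :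
    ∃ k₀, ∀ k, k₀ ≤ k → 1 ≤ k →
      ∃ g' : SLmod d (p ^ k) → Fin N, μ.real {x | g x ≠ g' (redP d p k x)} ≤ η := by
  have i0 : Fin N := g 1
  have hN : (0 : ℝ) < N := by exact_mod_cast i0.pos
  have hap : ∀ i : Fin N, ∃ t ∈ cylinders d p,
      μ (symmDiff t (g ⁻¹' {i})) < ENNReal.ofReal (η / N) := fun i =>
    exists_measure_symmDiff_lt_of_generateFrom_isSetRing isSetRing_cylinders
      ⟨{Set.univ}, Set.countable_singleton _, by
        rw [Set.singleton_subset_iff]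
        exact ⟨0, fun _ _ _ _ => trivial⟩, by simp⟩
      (by rw [‹BorelSpace (SLp d p)›.measurable_eq]
          exact isTopologicalBasis_cylinders.borel_eq_generateFrom)
      (hg (measurableSet_singleton i)) (ENNReal.ofReal_pos.2 (by positivity))
  choose t htC ht using hap
  choose m hm using htC
  refine ⟨Finset.univ.sup m, fun k hk hk1 => ?_⟩
  classical
  let pick : Set (Fin N) → Fin N := fun s => if h : s.Nonempty then h.some else i0
  let σ := Function.surjInv (redP_surjective (d := d) (p := p) hk1)
  have hmem : ∀ x i, σ (redP d p k x) ∈ t i ↔ x ∈ t i := by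
    intro x i
    have h1 : redP d p (m i) (σ (redP d p k x)) = redP d p (m i) x :=
      redP_eq_of_le ((Finset.le_sup (Finset.mem_univ i)).trans hk)
        (Function.surjInv_eq (redP_surjective (d := d) (p := p) hk1) _)
    exact ⟨hm i _ _ h1, hm i _ _ h1.symm⟩
  refine ⟨fun c => pick {i | σ c ∈ t i}, ?_⟩
  have hsub : {x | g x ≠ pick {i | σ (redP d p k x) ∈ t i}} ⊆
      ⋃ i, symmDiff (t i) (g ⁻¹' {i}) := by
    intro x hx
    by_contra hcon
    simp only [Set.mem_iUnion, not_exists, Set.mem_symmDiff, not_or, not_and, not_not,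
      Set.mem_preimage, Set.mem_singleton_iff] at hcon
    apply hx
    have h1 : {i | σ (redP d p k x) ∈ t i} = {g x} := by
      ext i
      rw [Set.mem_ofPred_eq, hmem, Set.mem_singleton_iff]
      exact ⟨fun h => ((hcon i).1 h).symm, fun h => (hcon i).2 h.symm⟩
    have h2 : pick {g x} = g x := by
      simp only [pick, Set.singleton_nonempty, dif_pos]
      exact (Set.singleton_nonempty (g x)).some_mem
    rw [h1, h2]
  calc _ ≤ μ.real (⋃ i, symmDiff (t i) (g ⁻¹' {i})) := measureReal_mono hsub
    _ ≤ ∑ i, μ.real (symmDiff (t i) (g ⁻¹' {i})) := measureReal_iUnion_fintype_le _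
    _ ≤ ∑ _i : Fin N, η / N := Finset.sum_le_sum fun i _ =>
        ENNReal.toReal_le_of_le_ofReal (by positivity) (ht i).le
    _ = η := by
        rw [Finset.sum_const, Finset.card_univ, Fintype.card_fin, nsmul_eq_mul]
        field_simp

end Cylinder

section Marginal

variable {X : Type*} [Group X] [MeasurableSpace X] (μ : Measure X) [IsProbabilityMeasure μ]
  {K : Type*} [Group K] [Fintype K] (π : X →* K)

theorem measureReal_fiber (hμ : ∀ g : X, MeasurePreserving (fun x => g * x) μ μ)
    (hπ : Function.Surjective π) (hm : ∀ c, MeasurableSet (π ⁻¹' {c})) (c : K) :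
    μ.real (π ⁻¹' {c}) = 1 / (Fintype.card K : ℝ) := by
  have hc : ∀ c, μ.real (π ⁻¹' {c}) = μ.real (π ⁻¹' {1}) := by
    intro c
    obtain ⟨g, rfl⟩ := hπ c
    rw [← (hμ g).measureReal_preimage (hm _).nullMeasurableSet]
    congr 1
    ext x
    simp
  have hsum := sum_measureReal_preimage_singleton (μ := μ) Finset.univ (f := π) fun c _ => hm c
  rw [Finset.coe_univ, Set.preimage_univ, probReal_univ, Finset.sum_congr rfl fun c _ => hc c,
    Finset.sum_const, Finset.card_univ, nsmul_eq_mul] at hsum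
  rw [hc, eq_div_iff (by positivity), mul_comm, hsum]

theorem measureReal_prod_preimage (hμ : ∀ g : X, MeasurePreserving (fun x => g * x) μ μ)
    (hπ : Function.Surjective π) (hm : ∀ c, MeasurableSet (π ⁻¹' {c})) (E : Finset (K × K)) :
    (μ.prod μ).real {w | (π w.1, π w.2) ∈ E} = E.card / (Fintype.card K : ℝ) ^ 2 := by
  have hpre : ∀ e : K × K, (fun w : X × X => (π w.1, π w.2)) ⁻¹' {e} =
      (π ⁻¹' {e.1}) ×ˢ (π ⁻¹' {e.2}) := fun e => by
    ext w
    simp [Prod.ext_iff]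
  have hsum := sum_measureReal_preimage_singleton (μ := μ.prod μ) E
    (f := fun w : X × X => (π w.1, π w.2))
    fun e _ => by rw [hpre]; exact (hm _).prod (hm _)
  rw [Finset.sum_congr rfl fun e _ => by
    rw [hpre, measureReal_prod_prod, measureReal_fiber μ π hμ hπ hm,
      measureReal_fiber μ π hμ hπ hm]] at hsum
  rw [Finset.sum_const, nsmul_eq_mul] at hsum
  refine hsum.symm.trans ?_
  ring

end Marginal

section StepBound

variable {d p : ℕ} [Fact p.Prime] [MeasurableSpace (SLp d p)] [BorelSpace (SLp d p)]
  (μ : Measure (SLp d p)) [IsProbabilityMeasure μ]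

theorem measurableSet_redP_fiber {k : ℕ} (hk : 1 ≤ k) (c : SLmod d (p ^ k)) :
    MeasurableSet (redP d p k ⁻¹' {c}) := by
  obtain ⟨a, rfl⟩ := redP_surjective (d := d) (p := p) hk c
  exact (isOpen_redP_fiber k a).measurableSet

theorem measurable_redP {k : ℕ} (hk : 1 ≤ k) :
    Measurable[_, ⊤] (redP d p k) := by
  have : NeZero (p ^ k) := ⟨pow_ne_zero _ (Fact.out : p.Prime).ne_zero⟩
  let : MeasurableSpace (SLmod d (p ^ k)) := ⊤
  exact measurable_to_countable' fun c => measurableSet_redP_fiber hk c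

omit [BorelSpace (SLp d p)] in
/-- Replacing a function by one that agrees with it off a set of measure `η` changes the vector
`Mp` by at most `2 * η`. -/
theorem abs_Mp_sub_le (hμ : ∀ g : SLp d p, MeasurePreserving (fun x => g * x) μ μ)
    (S : Finset (Matrix.SpecialLinearGroup (Fin d) ℤ)) (f f' : SLp d p × SLp d p → Fin 2)
    (hf : Measurable f) (hf' : Measurable f') (q : ↥S × Fin 2 × Fin 2) :
    |Mp d p μ S f q - Mp d p μ S f' q| ≤ 2 * (μ.prod μ).real {w | f w ≠ f' w} := by
  obtain ⟨γ, i, j⟩ := q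
  set T : SLp d p × SLp d p → SLp d p × SLp d p :=
    Prod.map (fun x => embZp d p γ * x) (fun x => embZp d p γ * x) with hT
  have hTm : MeasurePreserving T (μ.prod μ) (μ.prod μ) := (hμ _).prod (hμ _)
  have hbad : MeasurableSet {w | f w ≠ f' w} := (measurableSet_eq_fun hf hf').compl
  have hms : ∀ f : SLp d p × SLp d p → Fin 2, Measurable f →
      MeasurableSet {w | f w = i ∧ f (T w) = j} := fun f hf =>
    (hf (measurableSet_singleton i)).inter
      ((hf.comp hTm.measurable) (measurableSet_singleton j))
  calc _ ≤ (μ.prod μ).real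
          (symmDiff {w | f w = i ∧ f (T w) = j} {w | f' w = i ∧ f' (T w) = j}) :=
        abs_measureReal_sub_le_measureReal_symmDiff (hms f hf).nullMeasurableSet
          (hms f' hf').nullMeasurableSet
    _ ≤ (μ.prod μ).real ({w | f w ≠ f' w} ∪ T ⁻¹' {w | f w ≠ f' w}) := by
        refine measureReal_mono fun w hw => ?_
        by_contra hcon
        simp only [Set.mem_union, Set.mem_preimage, Set.mem_ofPred_eq, not_or, not_not] at hcon
        simp only [Set.mem_symmDiff, Set.mem_ofPred_eq, hcon.1, hcon.2, and_not_self,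
          or_self] at hw
    _ ≤ _ := by
        refine (measureReal_union_le _ _).trans (le_of_eq ?_)
        rw [hTm.measureReal_preimage hbad.nullMeasurableSet]
        ring

theorem Mp_comp_redP (hμ : ∀ g : SLp d p, MeasurePreserving (fun x => g * x) μ μ)
    (S : Finset (Matrix.SpecialLinearGroup (Fin d) ℤ)) {k : ℕ} (hk : 1 ≤ k)
    [Fintype (SLmod d (p ^ k))] [DecidableEq (SLmod d (p ^ k))]
    (f : SLmod d (p ^ k) × SLmod d (p ^ k) → Fin 2) (q : ↥S × Fin 2 × Fin 2) :
    Mp d p μ S (fun w => f (redP d p k w.1, redP d p k w.2)) q =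
      ((Finset.univ.filter fun w : SLmod d (p ^ k) × SLmod d (p ^ k) => f w = q.2.1 ∧
        f (redZ d (p ^ k) q.1 * w.1, redZ d (p ^ k) q.1 * w.2) = q.2.2).card : ℝ) /
        (Fintype.card (SLmod d (p ^ k)) : ℝ) ^ 2 := by
  rw [← measureReal_prod_preimage μ (redP d p k) hμ (redP_surjective hk)
    (measurableSet_redP_fiber hk)]
  simp only [Mp, map_mul, redP_embZp, Finset.mem_filter, Finset.mem_univ, true_and]
  rfl

theorem nontrivial_specialLinearGroup {R : Type*} [CommRing R] [Nontrivial R] (hd : 2 ≤ d) :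
    Nontrivial (Matrix.SpecialLinearGroup (Fin d) R) := by
  have hij : (⟨0, by omega⟩ : Fin d) ≠ ⟨1, by omega⟩ := by simp
  refine ⟨⟨Matrix.SpecialLinearGroup.transvection hij 1, 1, fun h => ?_⟩⟩
  have h1 := congrArg (fun M : Matrix.SpecialLinearGroup (Fin d) R =>
    M ⟨0, by omega⟩ ⟨1, by omega⟩) h
  simp [Matrix.SpecialLinearGroup.transvection_coe] at h1

theorem le_dist_uVec_Mp_of_step (hd : 2 ≤ d)
    (hμ : ∀ g : SLp d p, MeasurePreserving (fun x => g * x) μ μ)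
    (S : Finset (Matrix.SpecialLinearGroup (Fin d) ℤ)) {ε : ℝ} (hε : 0 < ε)
    (hch : ∀ k : ℕ, 1 ≤ k → ε ≤ cheeger (SLmod d (p ^ k)) (⇑(redZ d (p ^ k)) '' ↑S))
    {N : ℕ} (hp : 0 < (p - 1) / 2) (hN : 100 * N ^ 2 ≤ (p - 1) / 2)
    (g h : SLp d p → Fin N) (hg : Measurable g) (hh : Measurable h) (φ : Fin N × Fin N → Fin 2) :
    ε / (32 * S.card) ≤ dist (uVec S) (Mp d p μ S fun w => φ (g w.1, h w.2)) := by
  refine le_of_forall_pos_le_add fun η hη => ?_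
  obtain ⟨k₁, hk₁⟩ := exists_redP_approx μ g hg (show 0 < η / 4 by positivity)
  obtain ⟨k₂, hk₂⟩ := exists_redP_approx μ h hh (show 0 < η / 4 by positivity)
  set k := max 1 (max k₁ k₂) with hk
  have hk1 : 1 ≤ k := le_max_left _ _
  obtain ⟨g', hg'⟩ := hk₁ k ((le_max_left _ _).trans (le_max_right _ _)) hk1
  obtain ⟨h', hh'⟩ := hk₂ k ((le_max_right _ _).trans (le_max_right _ _)) hk1
  have : NeZero (p ^ k) := ⟨pow_ne_zero _ (Fact.out : p.Prime).ne_zero⟩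
  have : Fact (1 < p ^ k) := ⟨Nat.one_lt_pow (by omega) (Fact.out : p.Prime).one_lt⟩
  have : Nontrivial (SLmod d (p ^ k)) := nontrivial_specialLinearGroup hd
  classical
  obtain ⟨γ, hγ, i, j, hij⟩ := step_function_not_almost_invariant ((p - 1) / 2) hp
    (fun W ρ hρ => half_le_finrank_of_representation d p k hk1 ρ hρ) S (redZ d (p ^ k)) hε
    (hch k hk1) N hN g' h' φ
  set f : SLp d p × SLp d p → Fin 2 := fun w => φ (g w.1, h w.2) with hf
  set F : SLmod d (p ^ k) × SLmod d (p ^ k) → Fin 2 := fun w => φ (g' w.1, h' w.2) with hF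
  set f' : SLp d p × SLp d p → Fin 2 := fun w => F (redP d p k w.1, redP d p k w.2) with hf'
  have hMp := Mp_comp_redP μ hμ S hk1 F (⟨γ, hγ⟩, i, j)
  rw [← hf'] at hMp
  have hg'm : Measurable fun x => g' (redP d p k x) := by
    let : MeasurableSpace (SLmod d (p ^ k)) := ⊤
    exact measurable_from_top.comp (measurable_redP hk1)
  have hh'm : Measurable fun x => h' (redP d p k x) := by
    let : MeasurableSpace (SLmod d (p ^ k)) := ⊤
    exact measurable_from_top.comp (measurable_redP hk1)
  have hfm : Measurable f := (measurable_of_finite φ).comp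
    ((hg.comp measurable_fst).prodMk (hh.comp measurable_snd))
  have hf'm : Measurable f' := (measurable_of_finite φ).comp
    ((hg'm.comp measurable_fst).prodMk (hh'm.comp measurable_snd))
  have hbad : (μ.prod μ).real {w | f w ≠ f' w} ≤ η / 2 := by
    have hsub : {w | f w ≠ f' w} ⊆ ({x | g x ≠ g' (redP d p k x)} ×ˢ Set.univ) ∪
        (Set.univ ×ˢ {x | h x ≠ h' (redP d p k x)}) := by
      intro w hw
      by_contra hcon
      simp only [Set.mem_union, Set.mem_prod, Set.mem_ofPred_eq, Set.mem_univ, and_true, true_and,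
        not_or, not_not] at hcon
      apply hw
      simp only [hf, hf', hF, hcon.1, hcon.2]
    refine (measureReal_mono hsub).trans ((measureReal_union_le _ _).trans ?_)
    rw [measureReal_prod_prod, measureReal_prod_prod, probReal_univ]
    linarith
  have h1 := abs_Mp_sub_le μ hμ S f f' hfm hf'm (⟨γ, hγ⟩, i, j)
  have h2 := dist_le_pi_dist (uVec S) (Mp d p μ S f) (⟨γ, hγ⟩, i, j)
  rw [Real.dist_eq] at h2
  have h3 : ε / (32 * S.card) ≤
      |uVec S (⟨γ, hγ⟩, i, j) - Mp d p μ S f' (⟨γ, hγ⟩, i, j)| := by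
    rw [hMp]
    exact hij
  have h4 := abs_sub_le (uVec S (⟨γ, hγ⟩, i, j)) (Mp d p μ S f (⟨γ, hγ⟩, i, j))
    (Mp d p μ S f' (⟨γ, hγ⟩, i, j))
  linarith

theorem two_dvd_card_specialLinearGroup {R : Type*} [CommRing R] [Fintype R] [DecidableEq R]
    (hd : 2 ≤ d) (hR : (-1 : R) ≠ 1) :
    2 ∣ Nat.card (Matrix.SpecialLinearGroup (Fin d) R) := by
  have hij : (⟨0, by omega⟩ : Fin d) ≠ ⟨1, by omega⟩ := by simp
  have h1 : orderOf (diagPair hij (-1 : Rˣ)) = 2 := by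
    refine orderOf_eq_prime ?_ fun h => hR ?_
    · ext i j
      rw [Matrix.SpecialLinearGroup.coe_pow, diagPair_coe, Matrix.diagonal_pow,
        Matrix.SpecialLinearGroup.coe_one, ← Matrix.diagonal_one]
      congr 2
      ext k
      simp only [Pi.pow_apply]
      split_ifs <;> simp
    · have h1 := congrArg (fun M : Matrix.SpecialLinearGroup (Fin d) R =>
        M ⟨0, by omega⟩ ⟨0, by omega⟩) h
      simpa [diagPair_coe] using h1
  rw [← h1]
  exact orderOf_dvd_natCard _

/-- The vector `u` is attained by an exactly invariant function. -/
theorem exists_Mp_eq_uVec (hd : 2 ≤ d) (hp : p ≠ 2)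
    (hμ : ∀ g : SLp d p, MeasurePreserving (fun x => g * x) μ μ)
    (S : Finset (Matrix.SpecialLinearGroup (Fin d) ℤ)) :
    ∃ f : SLp d p × SLp d p → Fin 2, Measurable f ∧ Mp d p μ S f = uVec S := by
  have : NeZero (p ^ 1) := ⟨pow_ne_zero _ (Fact.out : p.Prime).ne_zero⟩
  have : Fact (2 < p ^ 1) := ⟨by
    have := (Fact.out : p.Prime).two_le
    rw [pow_one]
    omega⟩
  classical
  obtain ⟨m, hm⟩ : 2 ∣ Nat.card (SLmod d (p ^ 1)) :=
    two_dvd_card_specialLinearGroup hd ZMod.neg_one_ne_one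
  rw [Nat.card_eq_fintype_card] at hm
  obtain ⟨B, -, hB⟩ := Finset.exists_subset_card_eq
    (show m ≤ (Finset.univ : Finset (SLmod d (p ^ 1))).card by rw [Finset.card_univ]; omega)
  set F : SLmod d (p ^ 1) × SLmod d (p ^ 1) → Fin 2 :=
    fun w => if w.1⁻¹ * w.2 ∈ B then 1 else 0 with hF
  have hcard : ∀ i : Fin 2,
      (Finset.univ.filter fun z : SLmod d (p ^ 1) => (if z ∈ B then 1 else 0) = i).card = m := by
    intro i
    have h1 := Finset.card_filter_add_card_filter_not
      (s := (Finset.univ : Finset (SLmod d (p ^ 1)))) (· ∈ B)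
    rw [Finset.card_univ, hm, Finset.filter_univ_mem, hB] at h1
    fin_cases i
    · simp only [Fin.zero_eta, ite_eq_right_iff, one_ne_zero, imp_false]
      omega
    · simp [hB]
  have hcard2 : ∀ i : Fin 2, (Finset.univ.filter fun w => F w = i).card = 2 * m * m := by
    intro i
    rw [Finset.card_filter, Fintype.sum_prod_type]
    have h1 : ∀ x : SLmod d (p ^ 1), ∑ y, (if F (x, y) = i then 1 else 0) = m := by
      intro x
      rw [← hcard i, Finset.card_filter]
      exact Equiv.sum_comp (Equiv.mulLeft x⁻¹)
        fun z => if (if z ∈ B then (1 : Fin 2) else 0) = i then 1 else 0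
    rw [Finset.sum_congr rfl fun x _ => h1 x, Finset.sum_const, Finset.card_univ, hm, smul_eq_mul]
  have hm0 : 0 < m := by
    have : 0 < Fintype.card (SLmod d (p ^ 1)) := Fintype.card_pos
    omega
  refine ⟨fun w => F (redP d p 1 w.1, redP d p 1 w.2), ?_, ?_⟩
  · let : MeasurableSpace (SLmod d (p ^ 1)) := ⊤
    exact (measurable_of_finite F).comp
      (((measurable_redP le_rfl).comp measurable_fst).prodMk
        ((measurable_redP le_rfl).comp measurable_snd))
  · ext ⟨γ, i, j⟩
    rw [Mp_comp_redP μ hμ S le_rfl F]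
    have hinv : ∀ c w : SLmod d (p ^ 1) × SLmod d (p ^ 1),
        F (c.1 * w.1, c.1 * w.2) = F w := fun c w => by
      simp only [hF, mul_inv_rev, mul_assoc, inv_mul_cancel_left]
    have hinv' : ∀ c : SLmod d (p ^ 1), ∀ w, F (c * w.1, c * w.2) = F w := fun c => hinv (c, c)
    simp only [hinv', uVec]
    split_ifs with hij
    · subst hij
      simp only [and_self]
      rw [hcard2, hm]
      push_cast
      field_simp
    · have : ∀ w, ¬ (F w = i ∧ F w = j) := fun w h => hij (h.1.symm.trans h.2)
      simp [this]

end StepBound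

/-- Lemma 5.9 specialized to `𝒩 = ℳ = {p, p², p³, …}` (so that `G_𝒩 ≅ SL_d(ℤ_p)`):
if `S ⊆ Γ` is a finite symmetric set with `h(SL_d(ℤ/pᵏℤ), π_{pᵏ}(S)) ≥ ε` for all `k ≥ 1`,
`δ = ε/(32|S|)` and `N = ⌊√(p−1)/25⌋ ≥ 1`, and `α` is the left multiplication action of `Γ`
on `SL_d(ℤ_p)` equipped with the Haar probability measure `μ` (a left-invariant Borel
probability measure), then `u ∈ C(α×α,S,2)`, yet every `N`-step function
`f ∈ Step_{2,N}(SL_d(ℤ_p); SL_d(ℤ_p))` satisfies `dist_∞(u, M^{α×α}_{S,2}[f]) ≥ δ`. -/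
theorem main_lemma_padic (d p : ℕ) (hd : 2 ≤ d) [Fact p.Prime]
    [MeasurableSpace (SLp d p)] [BorelSpace (SLp d p)]
    (μ : Measure (SLp d p)) [IsProbabilityMeasure μ]
    (hHaar : ∀ g : SLp d p, MeasurePreserving (fun x => g * x) μ μ)
    (Γ : Subgroup (Matrix.SpecialLinearGroup (Fin d) ℤ)) (hinf : Infinite ↥Γ)
    (S : Finset (Matrix.SpecialLinearGroup (Fin d) ℤ))
    (hSsub : ↑S ⊆ (Γ : Set (Matrix.SpecialLinearGroup (Fin d) ℤ)))
    (hSsymm : ∀ γ ∈ S, γ⁻¹ ∈ S)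
    (ε : ℝ) (hε : 0 < ε)
    (hcheeger : ∀ k : ℕ, 1 ≤ k →
      ε ≤ cheeger (SLmod d (p ^ k)) (⇑(redZ d (p ^ k)) '' ↑S))
    (N : ℕ) (hN : N = Nat.floor (Real.sqrt ((p : ℝ) - 1) / 25)) (hN1 : 1 ≤ N) :
    uVec S ∈ closure {v | ∃ f : SLp d p × SLp d p → Fin 2,
        Measurable f ∧ Mp d p μ S f = v} ∧
    ∀ f : SLp d p × SLp d p → Fin 2,
      (∃ (g : SLp d p → Fin N) (h : SLp d p → Fin N) (φ : Fin N × Fin N → Fin 2),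
        Measurable g ∧ Measurable h ∧ ∀ w, f w = φ (g w.1, h w.2)) →
      ε / (32 * S.card) ≤ dist (uVec S) (Mp d p μ S f) := by
  have hp1 : (1 : ℝ) ≤ p := by exact_mod_cast (Fact.out : p.Prime).one_lt.le
  have h1 : (N : ℝ) ≤ Real.sqrt ((p : ℝ) - 1) / 25 := by
    rw [hN]
    exact Nat.floor_le (by positivity)
  have h2 : 625 * N ^ 2 + 1 ≤ p := by
    have h3 : (25 * N : ℝ) ^ 2 ≤ (p : ℝ) - 1 :=
      (Real.le_sqrt (by positivity) (by linarith)).1 (by linarith)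
    have h4 : ((625 * N ^ 2 + 1 : ℕ) : ℝ) ≤ p := by
      push_cast
      linarith
    exact_mod_cast h4
  have h3 : 1 ≤ N ^ 2 := Nat.one_le_pow _ _ hN1
  refine ⟨subset_closure (exists_Mp_eq_uVec μ hd (by omega) hHaar S), ?_⟩
  rintro f ⟨g, h, φ, hg, hh, hf⟩
  obtain rfl : f = fun w => φ (g w.1, h w.2) := funext hf
  exact le_dist_uVec_Mp_of_step μ hd hHaar S hε hcheeger (by omega) (by omega) g h hg hh φ
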